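/- arXiv:quant-ph/0402045 — 5 statements merged into one kernel-verified Lean document; each statement's English description precedes it below -/
import Mathlib

section
/- Let φ₁, φ₂, φ₃ be unit vectors in a complex inner product space H, and set F_{jk} := |⟨φ_j, φ_k⟩|². Then F₁₂ + F₁₃ + F₂₃ ≤ 1 + 2·√(F₁₂·F₁₃·F₂₃). -/
open scoped ComplexInnerProductSpace

/-- Nonnegativity of the Gram determinant of three unit vectors. -/
lemma normSq_inner_add_le_one_add_re
    {H : Type*} [NormedAddCommGroup H] [InnerProductSpace ℂ H]
    (x y z : H) (hx : ‖x‖ = 1) (hy : ‖y‖ = 1) (hz : ‖z‖ = 1) :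
    ‖⟪x, y⟫‖ ^ 2 + ‖⟪x, z⟫‖ ^ 2 + ‖⟪y, z⟫‖ ^ 2 ≤ 1 + 2 * (⟪x, y⟫ * ⟪y, z⟫ * ⟪z, x⟫).re := by
  have h := (Complex.le_def.1 (Matrix.posSemidef_gram ℂ ![x, y, z]).det_nonneg).1
  rw [Matrix.det_fin_three] at h
  simp only [Matrix.gram_apply, Matrix.cons_val, inner_self_eq_norm_sq_to_K, hx, hy, hz] at h
  rw [← inner_conj_symm y x, ← inner_conj_symm z x, ← inner_conj_symm z y] at h
  rw [← inner_conj_symm z x]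
  simp only [Complex.sq_norm, Complex.normSq_apply]
  simp [-inner_conj_symm] at h ⊢
  linarith

/-- For three unit vectors `φ₁, φ₂, φ₃` in a complex inner product space, the pairwise
fidelities `F_{jk} = |⟨φ_j, φ_k⟩|²` satisfy
`F₁₂ + F₁₃ + F₂₃ ≤ 1 + 2 √(F₁₂ F₁₃ F₂₃)`. -/
theorem fidelity_triple_ineq_pure
    {H : Type*} [NormedAddCommGroup H] [InnerProductSpace ℂ H]
    (φ₁ φ₂ φ₃ : H) (h₁ : ‖φ₁‖ = 1) (h₂ : ‖φ₂‖ = 1) (h₃ : ‖φ₃‖ = 1)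
    (F₁₂ F₁₃ F₂₃ : ℝ)
    (hF₁₂ : F₁₂ = ‖⟪φ₁, φ₂⟫‖ ^ 2)
    (hF₁₃ : F₁₃ = ‖⟪φ₁, φ₃⟫‖ ^ 2)
    (hF₂₃ : F₂₃ = ‖⟪φ₂, φ₃⟫‖ ^ 2) :
    F₁₂ + F₁₃ + F₂₃ ≤ 1 + 2 * Real.sqrt (F₁₂ * F₁₃ * F₂₃) := by
  subst hF₁₂ hF₁₃ hF₂₃
  rw [← mul_pow, ← mul_pow, Real.sqrt_sq (by positivity)]
  have hgram := normSq_inner_add_le_one_add_re φ₁ φ₂ φ₃ h₁ h₂ h₃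
  have hre := Complex.re_le_norm (⟪φ₁, φ₂⟫ * ⟪φ₂, φ₃⟫ * ⟪φ₃, φ₁⟫)
  rw [norm_mul, norm_mul, norm_inner_symm φ₃ φ₁] at hre
  linarith
end

section
/- Let λ, μ, ν : Fin N → ℝ be probability vectors (nonnegative entries summing to 1), and define the pairwise fidelities F₁₂ := (Σ_j √(λ_j·μ_j))², F₁₃ := (Σ_j √(λ_j·ν_j))², F₂₃ := (Σ_j √(μ_j·ν_j))². Then F₁₂ + F₁₃ + F₂₃ ≤ 1 + 2·√(F₁₂·F₁₃·F₂₃). -/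
/-- The classical fidelity (squared affinity) of two probability vectors on `Fin N`. -/
noncomputable def classicalFidelity {N : ℕ} (lam mu : Fin N → ℝ) : ℝ :=
  (∑ j, Real.sqrt (lam j * mu j)) ^ 2

/-- Nonnegativity of the Gram determinant of three unit vectors. -/
theorem gram_det_nonneg_of_unit {ι : Type*} (s : Finset ι) (x y z : ι → ℝ)
    (hx : ∑ j ∈ s, x j ^ 2 = 1) (hy : ∑ j ∈ s, y j ^ 2 = 1) (hz : ∑ j ∈ s, z j ^ 2 = 1) :
    (∑ j ∈ s, x j * y j) ^ 2 + (∑ j ∈ s, x j * z j) ^ 2 + (∑ j ∈ s, y j * z j) ^ 2 ≤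
      1 + 2 * ((∑ j ∈ s, x j * y j) * (∑ j ∈ s, x j * z j) * (∑ j ∈ s, y j * z j)) := by
  set a := ∑ j ∈ s, x j * y j with ha
  set b := ∑ j ∈ s, x j * z j with hb
  set c := ∑ j ∈ s, y j * z j with hc
  have cauchy := Finset.sum_mul_sq_le_sq_mul_sq s (fun j => y j - a * x j) (fun j => z j - b * x j)
  have huv : ∑ j ∈ s, (y j - a * x j) * (z j - b * x j) = c - a * b := by
    calc _ = ∑ j ∈ s, (y j * z j - b * (x j * y j) - a * (x j * z j) + a * b * x j ^ 2) :=
          Finset.sum_congr rfl fun j _ => by ring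
      _ = c - b * a - a * b + a * b * 1 := by
          rw [Finset.sum_add_distrib, Finset.sum_sub_distrib, Finset.sum_sub_distrib,
            ← Finset.mul_sum, ← Finset.mul_sum, ← Finset.mul_sum, hx]
      _ = c - a * b := by ring
  have hu : ∑ j ∈ s, (y j - a * x j) ^ 2 = 1 - a ^ 2 := by
    calc _ = ∑ j ∈ s, (y j ^ 2 - 2 * a * (x j * y j) + a ^ 2 * x j ^ 2) :=
          Finset.sum_congr rfl fun j _ => by ring
      _ = 1 - 2 * a * a + a ^ 2 * 1 := by
          rw [Finset.sum_add_distrib, Finset.sum_sub_distrib,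
            ← Finset.mul_sum, ← Finset.mul_sum, hx, hy]
      _ = 1 - a ^ 2 := by ring
  have hv : ∑ j ∈ s, (z j - b * x j) ^ 2 = 1 - b ^ 2 := by
    calc _ = ∑ j ∈ s, (z j ^ 2 - 2 * b * (x j * z j) + b ^ 2 * x j ^ 2) :=
          Finset.sum_congr rfl fun j _ => by ring
      _ = 1 - 2 * b * b + b ^ 2 * 1 := by
          rw [Finset.sum_add_distrib, Finset.sum_sub_distrib,
            ← Finset.mul_sum, ← Finset.mul_sum, hx, hz]
      _ = 1 - b ^ 2 := by ring
  rw [huv, hu, hv] at cauchy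
  linarith

/-- For three probability vectors on `Fin N`, the pairwise classical fidelities satisfy
`F₁₂ + F₁₃ + F₂₃ ≤ 1 + 2 √(F₁₂ F₁₃ F₂₃)`. -/
theorem fidelity_triple_ineq_classical {N : ℕ} (lam mu nu : Fin N → ℝ)
    (hlam : (∀ j, 0 ≤ lam j) ∧ ∑ j, lam j = 1)
    (hmu : (∀ j, 0 ≤ mu j) ∧ ∑ j, mu j = 1)
    (hnu : (∀ j, 0 ≤ nu j) ∧ ∑ j, nu j = 1)
    (F₁₂ F₁₃ F₂₃ : ℝ)
    (hF₁₂ : F₁₂ = classicalFidelity lam mu)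
    (hF₁₃ : F₁₃ = classicalFidelity lam nu)
    (hF₂₃ : F₂₃ = classicalFidelity mu nu) :
    F₁₂ + F₁₃ + F₂₃ ≤ 1 + 2 * Real.sqrt (F₁₂ * F₁₃ * F₂₃) := by
  subst hF₁₂ hF₁₃ hF₂₃
  have unit : ∀ p : Fin N → ℝ, ((∀ j, 0 ≤ p j) ∧ ∑ j, p j = 1) → ∑ j, √(p j) ^ 2 = 1 :=
    fun p hp => by rw [← hp.2]; exact Finset.sum_congr rfl fun j _ => Real.sq_sqrt (hp.1 j)
  have gram := gram_det_nonneg_of_unit Finset.univ (fun j => √(lam j)) (fun j => √(mu j))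
    (fun j => √(nu j)) (unit lam hlam) (unit mu hmu) (unit nu hnu)
  simp only [← Real.sqrt_mul (hlam.1 _), ← Real.sqrt_mul (hmu.1 _)] at gram
  unfold classicalFidelity
  rwa [← mul_pow, ← mul_pow, Real.sqrt_sq (by positivity)]
end

section
/- Let x₁, x₂, x₃ ∈ ℝ satisfy 0 ≤ x_j ≤ 1 for j = 1,2,3 and x₁² + x₂² + x₃² ≤ 1 + 2·x₁·x₂·x₃. Then there exist probability vectors λ₁, λ₂, λ₃ : Fin 6 → ℝ (nonnegative entries summing to 1) such that F(λ₁;λ₂) = x₁², F(λ₁;λ₃) = x₂², and F(λ₂;λ₃) = x₃². -/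
theorem classicalFidelity_sq_sq {N : ℕ} {v w : Fin N → ℝ} (hv : ∀ j, 0 ≤ v j)
    (hw : ∀ j, 0 ≤ w j) :
    classicalFidelity (fun j ↦ v j ^ 2) (fun j ↦ w j ^ 2) = (∑ j, v j * w j) ^ 2 := by
  simp only [classicalFidelity, ← mul_pow]
  simp only [Real.sqrt_sq (mul_nonneg (hv _) (hw _))]

theorem classicalFidelity_comm {N : ℕ} (lam mu : Fin N → ℝ) :
    classicalFidelity lam mu = classicalFidelity mu lam := by
  simp only [classicalFidelity, mul_comm]

/-- Entries of a nonnegative Cholesky factor of the correlation matrix with off-diagonal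
entries `a`, `b`, `c`. -/
theorem exists_nonneg_cholesky {a b c : ℝ} (ha : 0 ≤ a) (ha' : a ≤ 1) (hb : 0 ≤ b)
    (hb' : b ≤ 1) (habc : a * b ≤ c) (h : a ^ 2 + b ^ 2 + c ^ 2 ≤ 1 + 2 * a * b * c) :
    ∃ s t u : ℝ, 0 ≤ s ∧ 0 ≤ t ∧ 0 ≤ u ∧ a ^ 2 + s ^ 2 = 1 ∧ b ^ 2 + t ^ 2 + u ^ 2 = 1 ∧
      a * b + s * t = c := by
  have hcab : (c - a * b) ^ 2 ≤ (1 - a ^ 2) * (1 - b ^ 2) := by nlinarith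
  rcases ha'.eq_or_lt with rfl | hlt
  · have hc : c = b := by nlinarith [sq_nonneg (c - b)]
    refine ⟨0, 0, √(1 - b ^ 2), le_rfl, le_rfl, Real.sqrt_nonneg _, by norm_num, ?_, ?_⟩
    · rw [Real.sq_sqrt (by nlinarith)]; ring
    · simp [hc]
  · have hs : 0 < 1 - a ^ 2 := by nlinarith
    have ht : (c - a * b) ^ 2 / (1 - a ^ 2) ≤ 1 - b ^ 2 := by
      rw [div_le_iff₀ hs]; linarith
    have hs' : 0 < √(1 - a ^ 2) := Real.sqrt_pos.2 hs
    refine ⟨√(1 - a ^ 2), (c - a * b) / √(1 - a ^ 2),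
      √(1 - b ^ 2 - (c - a * b) ^ 2 / (1 - a ^ 2)), hs'.le,
      div_nonneg (by linarith) hs'.le, Real.sqrt_nonneg _, ?_, ?_, ?_⟩
    · rw [Real.sq_sqrt hs.le]; ring
    · rw [div_pow, Real.sq_sqrt hs.le, Real.sq_sqrt (by linarith)]; ring
    · rw [mul_div_cancel₀ _ hs'.ne']; ring

theorem exists_classicalFidelity_of_mul_le {a b c : ℝ} (ha : 0 ≤ a) (ha' : a ≤ 1) (hb : 0 ≤ b)
    (hb' : b ≤ 1) (habc : a * b ≤ c) (h : a ^ 2 + b ^ 2 + c ^ 2 ≤ 1 + 2 * a * b * c) :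
    ∃ lam₁ lam₂ lam₃ : Fin 6 → ℝ,
      ((∀ j, 0 ≤ lam₁ j) ∧ ∑ j, lam₁ j = 1) ∧
      ((∀ j, 0 ≤ lam₂ j) ∧ ∑ j, lam₂ j = 1) ∧
      ((∀ j, 0 ≤ lam₃ j) ∧ ∑ j, lam₃ j = 1) ∧
      classicalFidelity lam₁ lam₂ = a ^ 2 ∧
      classicalFidelity lam₁ lam₃ = b ^ 2 ∧
      classicalFidelity lam₂ lam₃ = c ^ 2 := by
  obtain ⟨s, t, u, hs, ht, hu, h₂, h₃, h₂₃⟩ := exists_nonneg_cholesky ha ha' hb hb' habc h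
  have nonneg₁ : ∀ j, 0 ≤ (![1, 0, 0, 0, 0, 0] : Fin 6 → ℝ) j := by
    intro j; fin_cases j <;> simp
  have nonneg₂ : ∀ j, 0 ≤ (![a, s, 0, 0, 0, 0] : Fin 6 → ℝ) j := by
    intro j; fin_cases j <;> simp [ha, hs]
  have nonneg₃ : ∀ j, 0 ≤ (![b, t, u, 0, 0, 0] : Fin 6 → ℝ) j := by
    intro j; fin_cases j <;> simp [hb, ht, hu]
  refine ⟨fun j ↦ ![1, 0, 0, 0, 0, 0] j ^ 2, fun j ↦ ![a, s, 0, 0, 0, 0] j ^ 2,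
    fun j ↦ ![b, t, u, 0, 0, 0] j ^ 2, ⟨fun _ ↦ sq_nonneg _, ?_⟩, ⟨fun _ ↦ sq_nonneg _, ?_⟩,
    ⟨fun _ ↦ sq_nonneg _, ?_⟩, ?_, ?_, ?_⟩
  · simp [Fin.sum_univ_succ]
  · simpa [Fin.sum_univ_succ] using h₂
  · simpa [Fin.sum_univ_succ, add_assoc] using h₃
  · rw [classicalFidelity_sq_sq nonneg₁ nonneg₂]; simp [Fin.sum_univ_succ]
  · rw [classicalFidelity_sq_sq nonneg₁ nonneg₃]; simp [Fin.sum_univ_succ]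
  · rw [classicalFidelity_sq_sq nonneg₂ nonneg₃, ← h₂₃]; simp [Fin.sum_univ_succ]

/-- Any triple `(x₁, x₂, x₃) ∈ [0,1]³` with `x₁² + x₂² + x₃² ≤ 1 + 2 x₁ x₂ x₃` can be
realised as the square roots of the pairwise fidelities of three probability measures
on a space with six points. -/
theorem triple_fidelity_realisable_classically
    (x₁ x₂ x₃ : ℝ)
    (h₁ : 0 ≤ x₁ ∧ x₁ ≤ 1) (h₂ : 0 ≤ x₂ ∧ x₂ ≤ 1) (h₃ : 0 ≤ x₃ ∧ x₃ ≤ 1)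
    (hineq : x₁ ^ 2 + x₂ ^ 2 + x₃ ^ 2 ≤ 1 + 2 * x₁ * x₂ * x₃) :
    ∃ lam₁ lam₂ lam₃ : Fin 6 → ℝ,
      ((∀ j, 0 ≤ lam₁ j) ∧ ∑ j, lam₁ j = 1) ∧
      ((∀ j, 0 ≤ lam₂ j) ∧ ∑ j, lam₂ j = 1) ∧
      ((∀ j, 0 ≤ lam₃ j) ∧ ∑ j, lam₃ j = 1) ∧
      classicalFidelity lam₁ lam₂ = x₁ ^ 2 ∧
      classicalFidelity lam₁ lam₃ = x₂ ^ 2 ∧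
      classicalFidelity lam₂ lam₃ = x₃ ^ 2 := by
  rcases le_total (x₁ * x₂) x₃ with h | h
  · exact exists_classicalFidelity_of_mul_le h₁.1 h₁.2 h₂.1 h₂.2 h hineq
  · have h' : x₁ * x₃ ≤ x₂ :=
      (mul_le_mul_of_nonneg_left h h₁.1).trans (by
        rw [← mul_assoc]
        exact mul_le_of_le_one_left h₂.1 (mul_le_one₀ h₁.2 h₁.1 h₁.2))
    obtain ⟨l₂, l₁, l₃, hl₂, hl₁, hl₃, h₂₁, h₂₃, h₁₃⟩ :=
      exists_classicalFidelity_of_mul_le h₁.1 h₁.2 h₃.1 h₃.2 h' (by linarith)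
    exact ⟨l₁, l₂, l₃, hl₁, hl₂, hl₃, (classicalFidelity_comm _ _).trans h₂₁, h₁₃, h₂₃⟩
end

section
/- Let φ₁, φ₂, φ₃ be unit vectors in a two-dimensional complex inner product space H. Then Re(⟨φ₁,φ₂⟩·⟨φ₂,φ₃⟩·⟨φ₃,φ₁⟩) = ½·(|⟨φ₁,φ₂⟩|² + |⟨φ₁,φ₃⟩|² + |⟨φ₂,φ₃⟩|² − 1). (Equivalently, for three pure states of a two-level system the cosine of the phase Φ(ω₁;ω₂;ω₃) equals (F₁₂ + F₁₃ + F₂₃ − 1)/(2√(F₁₂F₁₃F₂₃)) when all fidelities are nonzero.) -/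
open scoped ComplexInnerProductSpace

/-- For three unit vectors in a two-dimensional complex inner product space,
`Re(⟨φ₁,φ₂⟩⟨φ₂,φ₃⟩⟨φ₃,φ₁⟩) = ½(|⟨φ₁,φ₂⟩|² + |⟨φ₁,φ₃⟩|² + |⟨φ₂,φ₃⟩|² − 1)`;
equivalently, when all fidelities are nonzero, the cosine of the phase of the triple is
`(F₁₂ + F₁₃ + F₂₃ − 1)/(2 √(F₁₂ F₁₃ F₂₃))`. -/
theorem phase_cos_two_level
    {H : Type*} [NormedAddCommGroup H] [InnerProductSpace ℂ H]
    [FiniteDimensional ℂ H] (hdim : Module.finrank ℂ H = 2)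
    (φ₁ φ₂ φ₃ : H) (h₁ : ‖φ₁‖ = 1) (h₂ : ‖φ₂‖ = 1) (h₃ : ‖φ₃‖ = 1) :
    (⟪φ₁, φ₂⟫ * ⟪φ₂, φ₃⟫ * ⟪φ₃, φ₁⟫).re =
      (‖⟪φ₁, φ₂⟫‖ ^ 2 + ‖⟪φ₁, φ₃⟫‖ ^ 2 + ‖⟪φ₂, φ₃⟫‖ ^ 2 - 1) / 2 ∧
    (⟪φ₁, φ₂⟫ ≠ 0 → ⟪φ₁, φ₃⟫ ≠ 0 → ⟪φ₂, φ₃⟫ ≠ 0 →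
      Real.cos (Complex.arg (⟪φ₁, φ₂⟫ * ⟪φ₂, φ₃⟫ * ⟪φ₃, φ₁⟫)) =
        (‖⟪φ₁, φ₂⟫‖ ^ 2 + ‖⟪φ₁, φ₃⟫‖ ^ 2 + ‖⟪φ₂, φ₃⟫‖ ^ 2 - 1) /
          (2 * Real.sqrt (‖⟪φ₁, φ₂⟫‖ ^ 2 * (‖⟪φ₁, φ₃⟫‖ ^ 2 * ‖⟪φ₂, φ₃⟫‖ ^ 2)))) := by
  have hre : (⟪φ₁, φ₂⟫ * ⟪φ₂, φ₃⟫ * ⟪φ₃, φ₁⟫).re =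
      (‖⟪φ₁, φ₂⟫‖ ^ 2 + ‖⟪φ₁, φ₃⟫‖ ^ 2 + ‖⟪φ₂, φ₃⟫‖ ^ 2 - 1) / 2 := by
    have hdep : ¬ LinearIndependent ℂ ![φ₁, φ₂, φ₃] := fun h ↦ by
      have := h.fintype_card_le_finrank
      simp [hdim] at this
    have hdet : (Matrix.gram ℂ ![φ₁, φ₂, φ₃]).det = 0 :=
      not_not.1 fun h ↦ hdep (Matrix.det_gram_ne_zero_iff_linearIndependent.1 h)
    have hdet_re := congrArg Complex.re hdet
    have conj_re (x y : H) : ⟪y, x⟫.re = ⟪x, y⟫.re := inner_re_symm (𝕜 := ℂ) y x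
    have conj_im (x y : H) : ⟪y, x⟫.im = -⟪x, y⟫.im := inner_im_symm (𝕜 := ℂ) y x
    simp [Matrix.det_fin_three, Matrix.gram_apply, inner_self_eq_norm_sq_to_K, h₁, h₂, h₃,
      conj_re φ₁ φ₂, conj_im φ₁ φ₂, conj_re φ₁ φ₃, conj_im φ₁ φ₃,
      conj_re φ₂ φ₃, conj_im φ₂ φ₃] at hdet_re
    simp only [Complex.sq_norm, Complex.normSq_apply, Complex.mul_re, Complex.mul_im,
      conj_re φ₁ φ₃, conj_im φ₁ φ₃]
    linarith
  refine ⟨hre, fun h₁₂ h₁₃ h₂₃ ↦ ?_⟩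
  have h₃₁ : ⟪φ₃, φ₁⟫ ≠ 0 := by rwa [Ne, inner_eq_zero_symm]
  rw [Complex.cos_arg (mul_ne_zero (mul_ne_zero h₁₂ h₂₃) h₃₁), hre, ← mul_pow, ← mul_pow,
    Real.sqrt_sq (by positivity), norm_mul, norm_mul, norm_inner_symm φ₃ φ₁, div_div]
  congr 1
  ring
end

section
/- Let H and K be complex inner product spaces, let n ∈ ℕ, and let φ : Fin n → H and ψ : Fin n → K be families of unit vectors such that ⟨φ_j, φ_k⟩ ≠ 0 for all j, k. Assume that for all j, k: |⟨φ_j, φ_k⟩| = |⟨ψ_j, ψ_k⟩|, and that for all j, k, ℓ the triple products agree: ⟨φ_j,φ_k⟩·⟨φ_k,φ_ℓ⟩·⟨φ_ℓ,φ_j⟩ = ⟨ψ_j,ψ_k⟩·⟨ψ_k,ψ_ℓ⟩·⟨ψ_ℓ,ψ_j⟩. Then there exists z : Fin n → ℂ with |z_j| = 1 for all j such that ⟨ψ_j, ψ_k⟩ = conj(z_j)·z_k·⟨φ_j, φ_k⟩ for all j, k. (Hence the two sequences of pure states have identical Gram matrices after rephasing, so the sequence of pure states is uniquely determined, up to isometric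 transformations, by the pairwise fidelities |⟨φ_j,φ_k⟩|² and the phases of triples.) -/
open scoped ComplexInnerProductSpace

/-- Two families of unit vectors with nonzero pairwise overlaps, equal pairwise fidelities
and equal triple overlaps have identical Gram matrices after rephasing each vector by a
phase `z_j`: a sequence of pure states is determined, up to isometry, by the fidelities of
pairs and the phases of triples. -/
theorem gram_matrix_determined_by_fidelities_and_phases
    {H K : Type*} [NormedAddCommGroup H] [InnerProductSpace ℂ H]
    [NormedAddCommGroup K] [InnerProductSpace ℂ K]
    (n : ℕ) (φ : Fin n → H) (ψ : Fin n → K)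
    (hφ : ∀ j, ‖φ j‖ = 1) (hψ : ∀ j, ‖ψ j‖ = 1)
    (hne : ∀ j k, ⟪φ j, φ k⟫ ≠ 0)
    (habs : ∀ j k, ‖⟪φ j, φ k⟫‖ = ‖⟪ψ j, ψ k⟫‖)
    (htriple : ∀ j k ℓ, ⟪φ j, φ k⟫ * ⟪φ k, φ ℓ⟫ * ⟪φ ℓ, φ j⟫ =
      ⟪ψ j, ψ k⟫ * ⟪ψ k, ψ ℓ⟫ * ⟪ψ ℓ, ψ j⟫) :
    ∃ z : Fin n → ℂ, (∀ j, ‖z j‖ = 1) ∧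
      ∀ j k, ⟪ψ j, ψ k⟫ = star (z j) * z k * ⟪φ j, φ k⟫ := by
  obtain _ | m := n
  · exact ⟨fun _ => 1, fun j => j.elim0, fun j => j.elim0⟩
  have hneψ : ∀ j k, ⟪ψ j, ψ k⟫ ≠ 0 := fun j k => by
    rw [← norm_ne_zero_iff, ← habs, norm_ne_zero_iff]
    exact hne j k
  have hpair : ∀ j, ⟪φ 0, φ j⟫ * ⟪φ j, φ 0⟫ = ⟪ψ 0, ψ j⟫ * ⟪ψ j, ψ 0⟫ := fun j => by
    simpa [inner_self_eq_norm_sq_to_K, hφ, hψ] using htriple 0 j 0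
  refine ⟨fun k => ⟪ψ 0, ψ k⟫ / ⟪φ 0, φ k⟫, fun k => ?_, fun j k => ?_⟩
  · rw [norm_div, ← habs, div_self (norm_ne_zero_iff.mpr (hne 0 k))]
  · have hstar : star (⟪ψ 0, ψ j⟫ / ⟪φ 0, φ j⟫) = ⟪ψ j, ψ 0⟫ / ⟪φ j, φ 0⟫ := by
      rw [star_div₀, ← starRingEnd_apply, ← starRingEnd_apply, inner_conj_symm, inner_conj_symm]
    have hj : ⟪ψ j, ψ 0⟫ / ⟪φ j, φ 0⟫ = ⟪φ 0, φ j⟫ / ⟪ψ 0, ψ j⟫ := by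
      rw [div_eq_div_iff (hne j 0) (hneψ 0 j), hpair, mul_comm]
    have hk : ⟪ψ 0, ψ k⟫ / ⟪φ 0, φ k⟫ = ⟪φ k, φ 0⟫ / ⟪ψ k, ψ 0⟫ := by
      rw [div_eq_div_iff (hne 0 k) (hneψ k 0), ← hpair, mul_comm]
    simp only [hstar]
    rw [hj, hk, div_mul_div_comm, div_mul_eq_mul_div,
      eq_div_iff (mul_ne_zero (hneψ 0 j) (hneψ k 0))]
    linear_combination -htriple 0 j k
end
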